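/- arXiv:math/0612111 — 2 statements merged into one kernel-verified Lean document; each statement's English description precedes it below -/
import Mathlib

section
/- Let D be a division ring, n a natural number, and A an (n+1)×(n+1) matrix over D (indexed by Fin (n+1)). Fix indices i, j, and let M be the n×n minor of A obtained by deleting row i and column j, i.e., M = A.submatrix i.succAbove j.succAbove. Suppose A has a two-sided inverse A' (A·A' = 1 and A'·A = 1) and M has a two-sided inverse M'. Then the entry A'_{j i} of the inverse is itself invertible, with (A'_{j i})⁻¹ = A_{i j} − Σ_{l,k} A_{i, j.succAbove l} · M'_{l k} · A_{i.succAbove k, j}; equivalently, A'_{j i} · (A_{i j} − Σ_{l,k} A_{i, j.succAbove l} · M'_{l k} · A_{i.succAbove k, j}) = 1 and (A_{i j} − Σ_{l,k} A_{i, j.succAbove l} · M'_{l k} · A_{i.succAbove k, j}) · A'_{j i} = 1. -/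
open Matrix

theorem inverse_entry_quasideterminant {n : ℕ} {D : Type*} [DivisionRing D]
    (A A' : Matrix (Fin (n + 1)) (Fin (n + 1)) D)
    (i j : Fin (n + 1))
    (M' : Matrix (Fin n) (Fin n) D)
    (hA1 : A * A' = 1) (hA2 : A' * A = 1)
    (hM1 : A.submatrix i.succAbove j.succAbove * M' = 1)
    (hM2 : M' * A.submatrix i.succAbove j.succAbove = 1) :
    A' j i * (A i j - ∑ l, ∑ k, A i (j.succAbove l) * M' l k * A (i.succAbove k) j) = 1 ∧
    (A i j - ∑ l, ∑ k, A i (j.succAbove l) * M' l k * A (i.succAbove k) j) * A' j i = 1 := by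
  have hq : ∑ l, ∑ k, A i (j.succAbove l) * M' l k * A (i.succAbove k) j =
      ((fun l => A i (j.succAbove l)) ᵥ* M') ⬝ᵥ (fun k => A (i.succAbove k) j) := by
    simp only [dotProduct, vecMul, Finset.sum_mul]
    exact Finset.sum_comm
  have hcol : A' j i * A i j +
      (fun k => A' j (i.succAbove k)) ⬝ᵥ (fun k => A (i.succAbove k) j) = 1 := by
    have h := congrFun (congrFun hA2 j) j
    rwa [mul_apply, Fin.sum_univ_succAbove _ i, one_apply_eq] at h
  have hrow : (fun k => A' j (i.succAbove k)) ᵥ* A.submatrix i.succAbove j.succAbove =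
      -(A' j i • fun l => A i (j.succAbove l)) := by
    ext l
    have h := congrFun (congrFun hA2 j) (j.succAbove l)
    rw [mul_apply, Fin.sum_univ_succAbove _ i, one_apply_ne (Fin.succAbove_ne j l).symm] at h
    exact eq_neg_of_add_eq_zero_right h
  have hu : (fun k => A' j (i.succAbove k)) =
      -(A' j i • ((fun l => A i (j.succAbove l)) ᵥ* M')) := by
    rw [← smul_vecMul, ← neg_vecMul, ← hrow, vecMul_vecMul, hM1, vecMul_one]
  have key : A' j i *
      (A i j - ∑ l, ∑ k, A i (j.succAbove l) * M' l k * A (i.succAbove k) j) = 1 := by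
    rw [hq, mul_sub, sub_eq_add_neg, ← hcol, hu, neg_dotProduct, smul_dotProduct, smul_eq_mul]
  exact ⟨key, mul_eq_one_comm.mp key⟩
end

section
/- Let D be a division ring and let a, b, c, d be nonzero elements of D such that the four quasideterminants e₁ = a − b·d⁻¹·c, e₂ = c − d·b⁻¹·a, e₃ = b − a·c⁻¹·d, e₄ = d − c·a⁻¹·b are all nonzero. Then the 2×2 matrix !![a, b; c, d] is a two-sided inverse to the matrix !![e₁⁻¹, e₂⁻¹; e₃⁻¹, e₄⁻¹]: !![a, b; c, d] · !![e₁⁻¹, e₂⁻¹; e₃⁻¹, e₄⁻¹] = 1 and !![e₁⁻¹, e₂⁻¹; e₃⁻¹, e₄⁻¹] · !![a, b; c, d] = 1. -/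
open Matrix

theorem inv_sub_mul_inv_mul_eq_neg_left {D : Type*} [DivisionRing D] (a b : D) {c d : D}
    (hc : c ≠ 0) (hd : d ≠ 0) :
    (b - a * c⁻¹ * d)⁻¹ = -(d⁻¹ * (c * (a - b * d⁻¹ * c)⁻¹)) := by
  have h : b - a * c⁻¹ * d = -((a - b * d⁻¹ * c) * c⁻¹ * d) := by
    simp [sub_mul, mul_assoc, hc, hd]
  rw [h, inv_neg, _root_.mul_inv_rev, _root_.mul_inv_rev, inv_inv]

theorem inv_sub_mul_inv_mul_eq_neg_right {D : Type*} [DivisionRing D] (a c : D) {b d : D}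
    (hb : b ≠ 0) (hd : d ≠ 0) :
    (c - d * b⁻¹ * a)⁻¹ = -((a - b * d⁻¹ * c)⁻¹ * b * d⁻¹) := by
  have h : c - d * b⁻¹ * a = -(d * (b⁻¹ * (a - b * d⁻¹ * c))) := by
    simp [mul_sub, mul_assoc, hb, hd]
  rw [h, inv_neg, _root_.mul_inv_rev, _root_.mul_inv_rev, inv_inv]

theorem inverse_matrix_two_by_two {D : Type*} [DivisionRing D]
    (a b c d : D) (ha : a ≠ 0) (hb : b ≠ 0) (hc : c ≠ 0) (hd : d ≠ 0)
    (h1 : a - b * d⁻¹ * c ≠ 0) (h2 : c - d * b⁻¹ * a ≠ 0)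
    (h3 : b - a * c⁻¹ * d ≠ 0) (h4 : d - c * a⁻¹ * b ≠ 0) :
    !![a, b; c, d] * !![(a - b * d⁻¹ * c)⁻¹, (c - d * b⁻¹ * a)⁻¹;
        (b - a * c⁻¹ * d)⁻¹, (d - c * a⁻¹ * b)⁻¹] = 1 ∧
    !![(a - b * d⁻¹ * c)⁻¹, (c - d * b⁻¹ * a)⁻¹;
        (b - a * c⁻¹ * d)⁻¹, (d - c * a⁻¹ * b)⁻¹] * !![a, b; c, d] = 1 := by
  rw [Matrix.mul_fin_two, Matrix.mul_fin_two, Matrix.one_fin_two]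
  constructor
  · rw [inv_sub_mul_inv_mul_eq_neg_left a b hc hd, inv_sub_mul_inv_mul_eq_neg_left c d ha hb]
    have e11 := mul_inv_cancel₀ h1
    have e22 := mul_inv_cancel₀ h2
    generalize (a - b * d⁻¹ * c)⁻¹ = x at *
    generalize (c - d * b⁻¹ * a)⁻¹ = y at *
    simp only [mul_assoc, sub_eq_add_neg, neg_mul, add_mul] at e11 e22
    simp [e11, e22, hb, hd]
  · rw [inv_sub_mul_inv_mul_eq_neg_right a c hb hd, inv_sub_mul_inv_mul_eq_neg_right b d ha hc]
    have e11 := inv_mul_cancel₀ h1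
    have e22 := inv_mul_cancel₀ h3
    generalize (a - b * d⁻¹ * c)⁻¹ = x at *
    generalize (b - a * c⁻¹ * d)⁻¹ = y at *
    simp only [mul_assoc, sub_eq_add_neg, mul_neg, mul_add] at e11 e22
    simp [mul_assoc, e11, e22, hc, hd]
end
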